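/- arXiv:1206.2128 — 3 statements merged into one kernel-verified Lean document; each statement's English description precedes it below -/
import Mathlib

section
/- Let n ≥ 3 and let R be a commutative ring of stable rank 1. Then E(n,R) = U⁺·U⁻·H·U⁺; that is, every element of E(n,R) can be written as a product u₁·v·h·u₂ where u₁,u₂ are upper unitriangular matrices, v is a lower unitriangular matrix, and h is a diagonal matrix of determinant 1 lying in E(n,R). -/
open Matrix

/-- The elementary transvection `e + ξ e_{ij}` as an element of `SL(n,R)`. -/
def elemT {n : ℕ} {R : Type*} [CommRing R] (i j : Fin n) (hij : i ≠ j) (ξ : R) :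
    Matrix.SpecialLinearGroup (Fin n) R :=
  ⟨Matrix.transvection i j ξ, Matrix.det_transvection_of_ne i j hij ξ⟩

/-- The set of elementary transvections in `SL(n,R)`. -/
def elemSet (n : ℕ) (R : Type*) [CommRing R] :
    Set (Matrix.SpecialLinearGroup (Fin n) R) :=
  { g | ∃ i j : Fin n, ∃ hij : i ≠ j, ∃ ξ : R, g = elemT i j hij ξ }

/-- The elementary subgroup `E(n,R)` of `SL(n,R)`. -/
def elemSubgroup (n : ℕ) (R : Type*) [CommRing R] :
    Subgroup (Matrix.SpecialLinearGroup (Fin n) R) :=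
  Subgroup.closure (elemSet n R)

/-- `g` is a product of at most `N` elementary transvections. -/
def IsElemProd (n : ℕ) (R : Type*) [CommRing R] (N : ℕ)
    (g : Matrix.SpecialLinearGroup (Fin n) R) : Prop :=
  ∃ L : List (Matrix.SpecialLinearGroup (Fin n) R),
    L.length ≤ N ∧ (∀ x ∈ L, x ∈ elemSet n R) ∧ g = L.prod

/-- R has stable rank 1: whenever aR + bR = R, there is z with a + bz invertible. -/
def StableRankOne (R : Type*) [CommRing R] : Prop :=
  ∀ a b : R, Ideal.span {a, b} = ⊤ → ∃ z : R, IsUnit (a + b * z)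

/-- g is upper unitriangular: diagonal entries 1, entries below the diagonal 0. -/
def IsUpperUnitriangular {n : ℕ} {R : Type*} [CommRing R]
    (g : Matrix.SpecialLinearGroup (Fin n) R) : Prop :=
  (∀ i : Fin n, (g : Matrix (Fin n) (Fin n) R) i i = 1) ∧
    ∀ i j : Fin n, j < i → (g : Matrix (Fin n) (Fin n) R) i j = 0

/-- g is lower unitriangular: diagonal entries 1, entries above the diagonal 0. -/
def IsLowerUnitriangular {n : ℕ} {R : Type*} [CommRing R]
    (g : Matrix.SpecialLinearGroup (Fin n) R) : Prop :=
  (∀ i : Fin n, (g : Matrix (Fin n) (Fin n) R) i i = 1) ∧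
    ∀ i j : Fin n, i < j → (g : Matrix (Fin n) (Fin n) R) i j = 0

/-- g is a diagonal matrix. -/
def IsDiagonalSL {n : ℕ} {R : Type*} [CommRing R]
    (g : Matrix.SpecialLinearGroup (Fin n) R) : Prop :=
  ∀ i j : Fin n, i ≠ j → (g : Matrix (Fin n) (Fin n) R) i j = 0

/-- The matrix with corner `a`, first row `b`, first column `c` and remaining block `D`. -/
def borderedMatrix {n : ℕ} {R : Type*} (a : R) (b c : Fin n → R)
    (D : Matrix (Fin n) (Fin n) R) : Matrix (Fin (n + 1)) (Fin (n + 1)) R :=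
  Matrix.of (Fin.cons (Fin.cons a b) fun i => Fin.cons (c i) (D i))

section Bordered

variable {n : ℕ} {R : Type*}

@[simp] theorem borderedMatrix_zero_zero (a : R) (b c : Fin n → R)
    (D : Matrix (Fin n) (Fin n) R) : borderedMatrix a b c D 0 0 = a := rfl

@[simp] theorem borderedMatrix_zero_succ (a : R) (b c : Fin n → R)
    (D : Matrix (Fin n) (Fin n) R) (j : Fin n) : borderedMatrix a b c D 0 j.succ = b j := rfl

@[simp] theorem borderedMatrix_succ_zero (a : R) (b c : Fin n → R)
    (D : Matrix (Fin n) (Fin n) R) (i : Fin n) : borderedMatrix a b c D i.succ 0 = c i := rfl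

@[simp] theorem borderedMatrix_succ_succ (a : R) (b c : Fin n → R)
    (D : Matrix (Fin n) (Fin n) R) (i j : Fin n) :
    borderedMatrix a b c D i.succ j.succ = D i j := rfl

theorem eq_borderedMatrix (g : Matrix (Fin (n + 1)) (Fin (n + 1)) R) :
    g = borderedMatrix (g 0 0) (fun j => g 0 j.succ) (fun i => g i.succ 0)
      (g.submatrix Fin.succ Fin.succ) := by
  ext i j
  cases i using Fin.cases <;> cases j using Fin.cases <;> rfl

theorem borderedMatrix_mul [CommRing R] (a a' : R) (b b' c c' : Fin n → R)
    (D D' : Matrix (Fin n) (Fin n) R) :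
    borderedMatrix a b c D * borderedMatrix a' b' c' D' =
      borderedMatrix (a * a' + b ⬝ᵥ c') (a • b' + b ᵥ* D') (a' • c + D *ᵥ c')
        (vecMulVec c b' + D * D') := by
  ext i j
  cases i using Fin.cases <;> cases j using Fin.cases <;>
    simp [Matrix.mul_apply, Fin.sum_univ_succ, dotProduct, vecMul, mulVec, vecMulVec_apply,
      mul_comm]

theorem borderedMatrix_one [CommRing R] :
    borderedMatrix 1 0 0 (1 : Matrix (Fin n) (Fin n) R) = 1 := by
  ext i j
  cases i using Fin.cases <;> cases j using Fin.cases <;>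
    simp [Matrix.one_apply, Fin.succ_ne_zero, (Fin.succ_ne_zero _).symm]

theorem borderedMatrix_transvection [CommRing R] (i j : Fin n) (ξ : R) :
    borderedMatrix 1 0 0 (transvection i j ξ) = transvection i.succ j.succ ξ := by
  ext k l
  cases k using Fin.cases <;> cases l using Fin.cases <;>
    simp [transvection, Matrix.one_apply, Matrix.single_apply, Fin.succ_ne_zero,
      (Fin.succ_ne_zero _).symm]

theorem borderedMatrix_row_single [CommRing R] (j : Fin n) (ξ : R) :
    borderedMatrix 1 (Pi.single j ξ) 0 (1 : Matrix (Fin n) (Fin n) R) =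
      transvection 0 j.succ ξ := by
  ext k l
  cases k using Fin.cases <;> cases l using Fin.cases <;>
    simp [transvection, Matrix.one_apply, Matrix.single_apply, Fin.succ_ne_zero,
      (Fin.succ_ne_zero _).symm, Pi.single_apply, eq_comm]

theorem borderedMatrix_col_single [CommRing R] (i : Fin n) (ξ : R) :
    borderedMatrix 1 0 (Pi.single i ξ) (1 : Matrix (Fin n) (Fin n) R) =
      transvection i.succ 0 ξ := by
  ext k l
  cases k using Fin.cases <;> cases l using Fin.cases <;>
    simp [transvection, Matrix.one_apply, Matrix.single_apply, Fin.succ_ne_zero,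
      (Fin.succ_ne_zero _).symm, Pi.single_apply, eq_comm]

theorem isUnit_of_isUnit_borderedMatrix [CommRing R] {a : R} {S : Matrix (Fin n) (Fin n) R}
    (h : IsUnit (borderedMatrix a 0 0 S)) : IsUnit S := by
  obtain ⟨X, hX⟩ := h.exists_right_inv
  rw [eq_borderedMatrix X, borderedMatrix_mul] at hX
  refine IsUnit.of_mul_eq_one (X.submatrix Fin.succ Fin.succ) ?_
  ext i j
  have := congrFun (congrFun hX i.succ) j.succ
  simpa [Matrix.one_apply, vecMulVec_apply] using this

end Bordered

section Elementary

variable {n : ℕ} {R : Type*} [CommRing R]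

variable (n R) in
/-- The matrices underlying the elements of `E(n,R)`. -/
def elemMatrices : Submonoid (Matrix (Fin n) (Fin n) R) where
  carrier := { M | ∃ s ∈ elemSubgroup n R, (s : Matrix (Fin n) (Fin n) R) = M }
  one_mem' := ⟨1, one_mem _, rfl⟩
  mul_mem' := by
    rintro _ _ ⟨s, hs, rfl⟩ ⟨t, ht, rfl⟩
    exact ⟨s * t, mul_mem hs ht, rfl⟩

theorem transvection_mem_elemMatrices {i j : Fin n} (hij : i ≠ j) (ξ : R) :
    transvection i j ξ ∈ elemMatrices n R :=
  ⟨elemT i j hij ξ, Subgroup.subset_closure ⟨i, j, hij, ξ, rfl⟩, rfl⟩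

theorem borderedMatrix_row_mem (b : Fin n → R) :
    borderedMatrix 1 b 0 1 ∈ elemMatrices (n + 1) R := by
  rw [← Finset.univ_sum_single b]
  refine Finset.sum_induction _ (fun b => borderedMatrix 1 b 0 1 ∈ elemMatrices (n + 1) R)
    (fun b b' hb hb' => ?_) ?_ fun j _ => ?_
  · have := mul_mem hb' hb
    rw [borderedMatrix_mul] at this
    simpa using this
  · rw [borderedMatrix_one]
    exact one_mem _
  · rw [borderedMatrix_row_single]
    exact transvection_mem_elemMatrices (Fin.succ_ne_zero j).symm _

theorem borderedMatrix_col_mem (c : Fin n → R) :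
    borderedMatrix 1 0 c 1 ∈ elemMatrices (n + 1) R := by
  rw [← Finset.univ_sum_single c]
  refine Finset.sum_induction _ (fun c => borderedMatrix 1 0 c 1 ∈ elemMatrices (n + 1) R)
    (fun c c' hc hc' => ?_) ?_ fun i _ => ?_
  · have := mul_mem hc hc'
    rw [borderedMatrix_mul] at this
    simpa using this
  · rw [borderedMatrix_one]
    exact one_mem _
  · rw [borderedMatrix_col_single]
    exact transvection_mem_elemMatrices (Fin.succ_ne_zero i) _

theorem borderedMatrix_block_mem {D : Matrix (Fin n) (Fin n) R} (hD : D ∈ elemMatrices n R) :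
    borderedMatrix 1 0 0 D ∈ elemMatrices (n + 1) R := by
  obtain ⟨s, hs, rfl⟩ := hD
  induction hs using Subgroup.closure_induction'' with
  | mem x hx =>
    obtain ⟨i, j, hij, ξ, rfl⟩ := hx
    change borderedMatrix 1 0 0 (transvection i j ξ) ∈ _
    rw [borderedMatrix_transvection]
    exact transvection_mem_elemMatrices (by simpa using hij) ξ
  | inv_mem x hx =>
    obtain ⟨i, j, hij, ξ, rfl⟩ := hx
    have : (elemT i j hij ξ)⁻¹ = elemT i j hij (-ξ) := by
      rw [inv_eq_iff_mul_eq_one]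
      ext1 k l
      change (transvection i j ξ * transvection i j (-ξ)) k l = _
      rw [transvection_mul_transvection_same _ _ hij]
      simp
    rw [this]
    change borderedMatrix 1 0 0 (transvection i j (-ξ)) ∈ _
    rw [borderedMatrix_transvection]
    exact transvection_mem_elemMatrices (by simpa using hij) (-ξ)
  | one =>
    change borderedMatrix 1 0 0 (1 : Matrix (Fin n) (Fin n) R) ∈ _
    rw [borderedMatrix_one]
    exact one_mem _
  | mul x y _ _ hx hy =>
    have := mul_mem hx hy
    rw [borderedMatrix_mul] at this
    simpa using this

end Elementary

theorem StableRankOne.exists_isUnit_add_dotProduct {n : ℕ} {R : Type*} [CommRing R]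
    (hR : StableRankOne R) {g : Matrix (Fin (n + 1)) (Fin (n + 1)) R} (hg : IsUnit g) :
    ∃ b : Fin n → R, IsUnit (g 0 0 + b ⬝ᵥ fun i => g i.succ 0) := by
  obtain ⟨X, hX⟩ := hg.exists_left_inv
  have h := congrFun (congrFun hX 0) 0
  rw [Matrix.mul_apply, Fin.sum_univ_succ, Matrix.one_apply_eq] at h
  obtain ⟨z, hz⟩ := hR (g 0 0) (∑ i : Fin n, X 0 i.succ * g i.succ 0) <| by
    rw [Ideal.eq_top_iff_one, Ideal.mem_span_pair]
    exact ⟨X 0 0, 1, by rw [one_mul, h]⟩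
  refine ⟨z • fun i => X 0 i.succ, ?_⟩
  rw [smul_dotProduct, smul_eq_mul, mul_comm]
  exact hz

/-- Over a ring of stable rank 1, every invertible matrix is a product of unitriangular matrices
from `E(n,R)` and a diagonal matrix, in the order upper, lower, diagonal, upper. -/
theorem StableRankOne.exists_gauss_factorisation {R : Type*} [CommRing R] (hR : StableRankOne R) :
    ∀ (n : ℕ) (g : Matrix (Fin n) (Fin n) R), IsUnit g →
      ∃ u₁ ∈ elemMatrices n R, ∃ v ∈ elemMatrices n R, ∃ u₂ ∈ elemMatrices n R,
      ∃ h : Matrix (Fin n) (Fin n) R,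
        ((∀ i, u₁ i i = 1) ∧ ∀ i j, j < i → u₁ i j = 0) ∧
        ((∀ i, v i i = 1) ∧ ∀ i j, i < j → v i j = 0) ∧
        (∀ i j, i ≠ j → h i j = 0) ∧
        ((∀ i, u₂ i i = 1) ∧ ∀ i j, j < i → u₂ i j = 0) ∧
        g = u₁ * v * h * u₂ := by
  intro n
  induction n with
  | zero =>
    intro g _
    exact ⟨1, one_mem _, 1, one_mem _, 1, one_mem _, 1, by simp, by simp, by simp, by simp,
      Subsingleton.elim _ _⟩
  | succ n ih =>
    intro g hg
    obtain ⟨b, α, hα⟩ := hR.exists_isUnit_add_dotProduct hg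
    set c : Fin n → R := fun i => g i.succ 0
    set D := g.submatrix Fin.succ Fin.succ
    set r : Fin n → R := (fun j => g 0 j.succ) + b ᵥ* D
    set β : R := ↑α⁻¹
    have hαβ : (α : R) * β = 1 := α.mul_inv
    set S := D - vecMulVec (β • c) r
    have hfac : g = borderedMatrix 1 (-b) 0 1 * borderedMatrix 1 0 (β • c) 1 *
        borderedMatrix (α : R) 0 0 S * borderedMatrix 1 (β • r) 0 1 := by
      have hrow : g = borderedMatrix 1 (-b) 0 1 * borderedMatrix (α : R) r c D := by
        conv_lhs => rw [eq_borderedMatrix g]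
        rw [borderedMatrix_mul, hα]
        congr 1
        · simp [c]
        · simp [r, neg_vecMul, D]
        · simp [c]
        · simp [D]
      have hblock : borderedMatrix (α : R) r c D = borderedMatrix 1 0 (β • c) 1 *
          (borderedMatrix (α : R) 0 0 S * borderedMatrix 1 (β • r) 0 1) := by
        simp only [borderedMatrix_mul]
        congr 1
        · simp
        · simp [smul_smul, hαβ]
        · simp [smul_smul, hαβ]
        · simp [smul_smul, hαβ, S]
      rw [hrow, hblock]
      simp only [Matrix.mul_assoc]
    have hS : IsUnit S := by
      apply isUnit_of_isUnit_borderedMatrix (a := (α : R))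
      rw [hfac, isUnit_iff_isUnit_det, det_mul, det_mul, IsUnit.mul_iff, IsUnit.mul_iff] at hg
      exact (isUnit_iff_isUnit_det _).2 hg.1.2
    obtain ⟨u₁, hu₁, v, hv, u₂, hu₂, h, tu₁, tv, th, tu₂, hprod⟩ := ih S hS
    obtain ⟨w, hw⟩ : ∃ w : Matrix (Fin n) (Fin n) R, u₁ * w = 1 := by
      obtain ⟨s, -, rfl⟩ := hu₁
      exact ⟨(s⁻¹ : SpecialLinearGroup (Fin n) R), congrArg Subtype.val (mul_inv_cancel s)⟩
    refine ⟨borderedMatrix 1 (-b) 0 1 * borderedMatrix 1 0 0 u₁,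
      mul_mem (borderedMatrix_row_mem _) (borderedMatrix_block_mem hu₁),
      borderedMatrix 1 0 (w *ᵥ (β • c)) 1 * borderedMatrix 1 0 0 v,
      mul_mem (borderedMatrix_col_mem _) (borderedMatrix_block_mem hv),
      borderedMatrix 1 0 0 u₂ * borderedMatrix 1 (β • r) 0 1,
      mul_mem (borderedMatrix_block_mem hu₂) (borderedMatrix_row_mem _),
      borderedMatrix (α : R) 0 0 h, ?_, ?_, ?_, ?_, ?_⟩
    · rw [borderedMatrix_mul]
      refine ⟨fun i => ?_, fun i j hij => ?_⟩
      · cases i using Fin.cases <;> simp [tu₁.1]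
      · cases i using Fin.cases <;> cases j using Fin.cases <;>
          simp at hij <;> simp [*, tu₁.2]
    · rw [borderedMatrix_mul]
      refine ⟨fun i => ?_, fun i j hij => ?_⟩
      · cases i using Fin.cases <;> simp [tv.1]
      · cases i using Fin.cases <;> cases j using Fin.cases <;>
          simp at hij <;> simp [*, tv.2]
    · intro i j hij
      cases i using Fin.cases <;> cases j using Fin.cases <;> simp at hij <;> simp [th, hij]
    · rw [borderedMatrix_mul]
      refine ⟨fun i => ?_, fun i j hij => ?_⟩
      · cases i using Fin.cases <;> simp [tu₂.1]
      · cases i using Fin.cases <;> cases j using Fin.cases <;>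
          simp at hij <;> simp [*, tu₂.2]
    · have hmid : borderedMatrix 1 0 (β • c) 1 * borderedMatrix (α : R) 0 0 S =
          borderedMatrix 1 0 0 u₁ * (borderedMatrix 1 0 (w *ᵥ (β • c)) 1 *
            borderedMatrix 1 0 0 v) * borderedMatrix (α : R) 0 0 h * borderedMatrix 1 0 0 u₂ := by
        simp only [borderedMatrix_mul]
        congr 1 <;> simp [hprod, hw, Matrix.mul_assoc, mulVec_smul]
      rw [hfac, Matrix.mul_assoc (borderedMatrix 1 (-b) 0 1), hmid]
      simp only [Matrix.mul_assoc]

/-- For n ≥ 3 and sr(R) = 1, E(n,R) = U⁺U⁻HU⁺ (Gauss decomposition). -/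
theorem elem_eq_gauss_factorisation (n : ℕ) (hn : 3 ≤ n)
    (R : Type*) [CommRing R] (hR : StableRankOne R) :
    ∀ g ∈ elemSubgroup n R,
      ∃ u₁ v h u₂ : Matrix.SpecialLinearGroup (Fin n) R,
        IsUpperUnitriangular u₁ ∧ IsLowerUnitriangular v ∧
        IsDiagonalSL h ∧ h ∈ elemSubgroup n R ∧
        IsUpperUnitriangular u₂ ∧
        g = u₁ * v * h * u₂ := by
  intro g hg
  have hunit : IsUnit (g : Matrix (Fin n) (Fin n) R) :=
    (isUnit_iff_isUnit_det _).2 (by rw [g.det_coe]; exact isUnit_one)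
  obtain ⟨_, ⟨u₁, hu₁, rfl⟩, _, ⟨v, hv, rfl⟩, _, ⟨u₂, hu₂, rfl⟩, h, tu₁, tv, th, tu₂, hprod⟩ :=
    hR.exists_gauss_factorisation n g hunit
  have hh : ((v⁻¹ * u₁⁻¹ * g * u₂⁻¹ : SpecialLinearGroup (Fin n) R) :
      Matrix (Fin n) (Fin n) R) = h := by
    have hu₁' : u₁⁻¹.1 * u₁.1 = 1 := congrArg Subtype.val (inv_mul_cancel u₁)
    have hv' : v⁻¹.1 * v.1 = 1 := congrArg Subtype.val (inv_mul_cancel v)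
    have hu₂' : u₂.1 * u₂⁻¹.1 = 1 := congrArg Subtype.val (mul_inv_cancel u₂)
    calc (v⁻¹ * u₁⁻¹ * g * u₂⁻¹ : SpecialLinearGroup (Fin n) R).1
        = v⁻¹.1 * u₁⁻¹.1 * (u₁.1 * v.1 * h * u₂.1) * u₂⁻¹.1 := by rw [← hprod]; rfl
      _ = v⁻¹.1 * ((u₁⁻¹.1 * u₁.1) * v.1) * h * (u₂.1 * u₂⁻¹.1) := by
          simp only [Matrix.mul_assoc]
      _ = h := by
          rw [hu₁', Matrix.one_mul, hv', hu₂', Matrix.one_mul, Matrix.mul_one]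
  refine ⟨u₁, v, v⁻¹ * u₁⁻¹ * g * u₂⁻¹, u₂, tu₁, tv, ?_, ?_, tu₂, by group⟩
  · intro i j hij
    rw [hh]
    exact th i j hij
  · exact mul_mem (mul_mem (mul_mem (inv_mem hv) (inv_mem hu₁)) hg) (inv_mem hu₂)
end

section
/- Let R be a commutative ring and n ≥ 3. Assume u ∈ Rⁿ is a unimodular column and v is a row of length n over R such that v·u = 0. Then the matrix e + u·v lies in SL(n,R) and is a product of at most n(n−1)(n+2) elementary transvections. -/
open Matrix

/-- `A` is the matrix of a product of at most `N` elementary transvections. -/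
def IsElemProdMatrix {n : ℕ} {R : Type*} [CommRing R] (N : ℕ) (A : Matrix (Fin n) (Fin n) R) :
    Prop :=
  ∃ g : Matrix.SpecialLinearGroup (Fin n) R,
    (g : Matrix (Fin n) (Fin n) R) = A ∧ IsElemProd n R N g

namespace IsElemProdMatrix

variable {n : ℕ} {R : Type*} [CommRing R] {M N : ℕ} {A B : Matrix (Fin n) (Fin n) R}

theorem one : IsElemProdMatrix 0 (1 : Matrix (Fin n) (Fin n) R) :=
  ⟨1, rfl, [], by simp, by simp, by simp⟩

theorem mul (hA : IsElemProdMatrix M A) (hB : IsElemProdMatrix N B) :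
    IsElemProdMatrix (M + N) (A * B) := by
  obtain ⟨g, rfl, L, hL, hLs, rfl⟩ := hA
  obtain ⟨h, rfl, L', hL', hLs', rfl⟩ := hB
  refine ⟨L.prod * L'.prod, by simp, L ++ L', by simp; omega, ?_, by simp⟩
  intro x hx
  rcases List.mem_append.1 hx with hx | hx
  exacts [hLs x hx, hLs' x hx]

theorem one_add_single {i j : Fin n} (hij : i ≠ j) (ξ : R) :
    IsElemProdMatrix 1 (1 + Matrix.single i j ξ) :=
  ⟨elemT i j hij ξ, rfl, [elemT i j hij ξ], by simp,
    by simpa using ⟨i, j, hij, ξ, rfl⟩, by simp⟩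

/-- If the products `f a * f b` vanish, then `1 + ∑ f a` is the product of the `1 + f a`. -/
theorem one_add_sum {ι : Type*} [DecidableEq ι] (s : Finset ι)
    (f : ι → Matrix (Fin n) (Fin n) R)
    (hf : ∀ a ∈ s, IsElemProdMatrix N (1 + f a)) (h0 : ∀ a ∈ s, ∀ b ∈ s, f a * f b = 0) :
    IsElemProdMatrix (s.card * N) (1 + ∑ a ∈ s, f a) := by
  induction s using Finset.induction_on with
  | empty => simpa using one
  | insert a s ha ih =>
    have key := (hf a (Finset.mem_insert_self a s)).mul
      (ih (fun b hb => hf b (Finset.mem_insert_of_mem hb))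
        fun b hb c hc => h0 b (Finset.mem_insert_of_mem hb) c (Finset.mem_insert_of_mem hc))
    have hz : f a * ∑ b ∈ s, f b = 0 := by
      rw [Finset.mul_sum]
      exact Finset.sum_eq_zero fun b hb =>
        h0 a (Finset.mem_insert_self a s) b (Finset.mem_insert_of_mem hb)
    rw [Finset.sum_insert ha, Finset.card_insert_of_notMem ha]
    convert key using 1
    · ring
    · simp only [add_mul, mul_add, one_mul, mul_one, hz]; abel

/-- A block of entries `M k l` with `k ∈ s`, `l ∈ t` and `s`, `t` disjoint needs `|s| |t|`
elementary transvections. -/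
theorem one_add_block {s t : Finset (Fin n)} (hst : Disjoint s t) (c : Fin n → Fin n → R) :
    IsElemProdMatrix (s.card * t.card) (1 + ∑ k ∈ s, ∑ l ∈ t, Matrix.single k l (c k l)) := by
  have hne : ∀ k ∈ s, ∀ l ∈ t, k ≠ l := fun k hk l hl e =>
    Finset.disjoint_left.1 hst hk (e ▸ hl)
  have := one_add_sum (s ×ˢ t) (fun p => Matrix.single p.1 p.2 (c p.1 p.2)) (N := 1)
    (fun p hp => one_add_single
      (hne _ (Finset.mem_product.1 hp).1 _ (Finset.mem_product.1 hp).2) _)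
    (fun p hp q hq => Matrix.single_mul_single_of_ne _ _ _ _
      (hne _ (Finset.mem_product.1 hq).1 _ (Finset.mem_product.1 hp).2).symm _)
  rwa [Finset.card_product, mul_one, Finset.sum_product] at this

/-- If `P² = Q² = QP = 0`, then `1 + PQ` is the commutator of `1 + P` and `1 + Q`. -/
theorem one_add_mul {P Q : Matrix (Fin n) (Fin n) R} (hPP : P * P = 0) (hQQ : Q * Q = 0)
    (hQP : Q * P = 0) (hP : IsElemProdMatrix M (1 + P)) (hP' : IsElemProdMatrix M (1 - P))
    (hQ : IsElemProdMatrix N (1 + Q)) (hQ' : IsElemProdMatrix N (1 - Q)) :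
    IsElemProdMatrix (2 * M + 2 * N) (1 + P * Q) := by
  have key := (hP.mul hQ).mul (hP'.mul hQ')
  have h1 : (1 + P) * (1 + Q) * ((1 - P) * (1 - Q)) = 1 + P * Q := by
    have : (1 + P) * (1 + Q) * ((1 - P) * (1 - Q)) =
        1 + P * Q - P * P + P * P * Q - Q * P + Q * P * Q - Q * Q - P * (Q * P)
          + P * (Q * P) * Q - P * (Q * Q) := by noncomm_ring
    rw [this]; simp [hPP, hQQ, hQP]
  rw [h1] at key
  convert key using 1
  ring

private theorem vecMulVec_mul_eq_zero {p q r s : Fin n → R} (h : q ⬝ᵥ r = 0) :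
    Matrix.vecMulVec p q * Matrix.vecMulVec r s = 0 := by
  rw [Matrix.vecMulVec_mul_vecMulVec, h, zero_smul, Matrix.vecMulVec_zero]

theorem one_add_vecMulVec_of_support {s t : Finset (Fin n)} (hst : Disjoint s t)
    {p q : Fin n → R} (hp : ∀ k ∉ s, p k = 0) (hq : ∀ l ∉ t, q l = 0) :
    IsElemProdMatrix (s.card * t.card) (1 + Matrix.vecMulVec p q) := by
  convert one_add_block hst (fun k l => p k * q l) using 2
  ext a b
  simp only [Matrix.sum_apply, Matrix.single_apply, Matrix.vecMulVec_apply, ite_and,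
    Finset.sum_ite_irrel, Finset.sum_const_zero, Finset.sum_ite_eq']
  split_ifs with ha hb
  · rfl
  · simp [hq b hb]
  · simp [hp a ha]

/-- The case where the row has the shape `a (u_j e_i - u_i e_j)`. -/
theorem one_add_vecMulVec_pair (hn : 3 ≤ n) (u : Fin n → R) {i j : Fin n} (hij : i ≠ j) (a : R) :
    IsElemProdMatrix (2 * n + 4)
      (1 + Matrix.vecMulVec u (Pi.single i (a * u j) - Pi.single j (a * u i))) := by
  set r : Fin n → R := Pi.single i (a * u j) - Pi.single j (a * u i) with hr
  set p : Fin n → R := Pi.single i (u i) + Pi.single j (u j) with hp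
  obtain ⟨k, hk⟩ : ∃ k, k ∉ ({i, j} : Finset (Fin n)) := by
    by_contra! h
    have := Finset.card_le_card (fun x _ => h x : Finset.univ ⊆ ({i, j} : Finset (Fin n)))
    simp [Finset.card_pair hij] at this
    omega
  have hcard : ({i, j} : Finset (Fin n)).card = 2 := Finset.card_pair hij
  have hr0 : ∀ l ∉ ({i, j} : Finset (Fin n)), r l = 0 := by
    intro l hl
    simp only [Finset.mem_insert, Finset.mem_singleton, not_or] at hl
    simp [hr, hl.1, hl.2]
  have hp0 : ∀ l ∉ ({i, j} : Finset (Fin n)), p l = 0 := by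
    intro l hl
    simp only [Finset.mem_insert, Finset.mem_singleton, not_or] at hl
    simp [hp, hl.1, hl.2]
  have hq0 : ∀ l ∉ ({i, j} : Finset (Fin n))ᶜ, (u - p) l = 0 := by
    intro l hl
    simp only [Finset.mem_compl, not_not, Finset.mem_insert, Finset.mem_singleton] at hl
    rcases hl with rfl | rfl
    · simp [hp, hij]
    · simp [hp, hij.symm]
  have hrp : r ⬝ᵥ p = 0 := by
    simp [hr, hp, hij, hij.symm]
    ring
  have hk0 : ∀ (l : Fin n), l ∉ ({k} : Finset (Fin n)) → (Pi.single k 1 : Fin n → R) l = 0 := by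
    intro l hl
    simp only [Finset.mem_singleton] at hl
    simp [hl]
  have hdk : Disjoint ({i, j} : Finset (Fin n)) {k} := Finset.disjoint_singleton_right.2 hk
  have h1 : IsElemProdMatrix ((n - 2) * 2) (1 + Matrix.vecMulVec (u - p) r) := by
    have := one_add_vecMulVec_of_support (s := ({i, j} : Finset (Fin n))ᶜ) (t := {i, j})
      disjoint_compl_left hq0 hr0
    rwa [Finset.card_compl, hcard, Fintype.card_fin] at this
  have hcol : ∀ p' : Fin n → R, (∀ l ∉ ({i, j} : Finset (Fin n)), p' l = 0) →
      IsElemProdMatrix 2 (1 + Matrix.vecMulVec p' (Pi.single k 1)) := by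
    intro p' hp'
    simpa [hcard] using one_add_vecMulVec_of_support hdk hp' hk0
  have hrow : ∀ r' : Fin n → R, (∀ l ∉ ({i, j} : Finset (Fin n)), r' l = 0) →
      IsElemProdMatrix 2 (1 + Matrix.vecMulVec (Pi.single k 1) r') := by
    intro r' hr'
    simpa [hcard] using one_add_vecMulVec_of_support hdk.symm hk0 hr'
  have h2 : IsElemProdMatrix (2 * 2 + 2 * 2) (1 + Matrix.vecMulVec p r) := by
    have := one_add_mul (P := Matrix.vecMulVec p (Pi.single k 1))
      (Q := Matrix.vecMulVec (Pi.single k 1) r)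
      (vecMulVec_mul_eq_zero (by simp [hp0 k hk]))
      (vecMulVec_mul_eq_zero (by simp [hr0 k hk]))
      (vecMulVec_mul_eq_zero hrp) (hcol p hp0)
      (by simpa [Matrix.neg_vecMulVec, sub_eq_add_neg] using
        hcol (-p) (fun l hl => by simp [hp0 l hl]))
      (hrow r hr0)
      (by simpa [Matrix.vecMulVec_neg, sub_eq_add_neg] using
        hrow (-r) (fun l hl => by simp [hr0 l hl]))
    simpa [Matrix.vecMulVec_mul_vecMulVec] using this
  have h3 := h1.mul h2
  have h4 : (1 + Matrix.vecMulVec (u - p) r) * (1 + Matrix.vecMulVec p r) =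
      1 + Matrix.vecMulVec u r := by
    rw [add_mul, mul_add, mul_add, vecMulVec_mul_eq_zero hrp, Matrix.sub_vecMulVec]
    simp
  rw [h4] at h3
  convert h3 using 1
  omega

end IsElemProdMatrix

/-- The number of pairs `i < j` in `Fin n`, doubled. -/
theorem card_sigma_Ioi_mul_two (n : ℕ) :
    (Finset.univ.sigma fun i : Fin n => Finset.Ioi i).card * 2 = n * (n - 1) := by
  have := Finset.sum_sum_Ioi_add_eq_sum_sum_off_diag (fun _ _ : Fin n => 1)
  simpa [Finset.card_sigma, Finset.sum_mul, Finset.card_compl] using this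

/-- A row orthogonal to a unimodular column is a combination of the rows `u_j e_i - u_i e_j`. -/
theorem eq_sum_pairs_of_orthogonal {n : ℕ} {R : Type*} [CommRing R] {u v w : Fin n → R}
    (hw : ∑ i, w i * u i = 1) (hvu : ∑ i, v i * u i = 0) :
    v = ∑ i, ∑ j ∈ Finset.Ioi i, (Pi.single i ((v i * w j - v j * w i) * u j)
      - Pi.single j ((v i * w j - v j * w i) * u i)) := by
  have key := Finset.sum_sum_Ioi_add_eq_sum_sum_off_diag
    (fun i j : Fin n => (Pi.single j ((v j * w i - v i * w j) * u i) : Fin n → R))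
  have h1 : ∑ i, ∑ j ∈ Finset.Ioi i, ((Pi.single i ((v i * w j - v j * w i) * u j) : Fin n → R)
      - Pi.single j ((v i * w j - v j * w i) * u i)) =
      ∑ i, ∑ j ∈ ({i}ᶜ : Finset (Fin n)), Pi.single i ((v i * w j - v j * w i) * u j) := by
    rw [← key]
    refine Finset.sum_congr rfl fun i _ => Finset.sum_congr rfl fun j _ => ?_
    rw [sub_eq_add_neg, ← Pi.single_neg]
    congr 2
    ring
  rw [h1]
  have h2 : ∀ i : Fin n, ∑ j ∈ ({i}ᶜ : Finset (Fin n)),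
      (Pi.single i ((v i * w j - v j * w i) * u j) : Fin n → R) = Pi.single i (v i) := by
    intro i
    have hc := Finset.sum_compl_add_sum ({i} : Finset (Fin n))
      (fun j => (Pi.single i ((v i * w j - v j * w i) * u j) : Fin n → R))
    rw [Finset.sum_singleton] at hc
    have hs : ∑ j, (v i * w j - v j * w i) * u j = v i := by
      calc ∑ j, (v i * w j - v j * w i) * u j
          = v i * ∑ j, w j * u j - w i * ∑ j, v j * u j := by
            rw [Finset.mul_sum, Finset.mul_sum, ← Finset.sum_sub_distrib]
            exact Finset.sum_congr rfl fun j _ => by ring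
        _ = v i := by rw [hw, hvu]; ring
    have ht : ∑ j, (Pi.single i ((v i * w j - v j * w i) * u j) : Fin n → R)
        = Pi.single i (v i) := by
      conv_rhs => rw [← hs]
      exact (map_sum (AddMonoidHom.single (fun _ : Fin n => R) i) _ _).symm
    rw [← ht, ← hc]
    simp
  simp_rw [h2]
  exact (Finset.univ_sum_single v).symm

/-- Suslin's factorisation: if u is a unimodular column and v a row with v·u = 0,
then e + u·v lies in SL(n,R) and is a product of at most n(n−1)(n+2) elementary
transvections. -/
theorem transvection_unimodular_is_elemProd (n : ℕ) (hn : 3 ≤ n)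
    (R : Type*) [CommRing R] (u : Fin n → R) (v : Fin n → R)
    (hu : Ideal.span (Set.range u) = ⊤)
    (hvu : ∑ i : Fin n, v i * u i = 0) :
    ∃ g : Matrix.SpecialLinearGroup (Fin n) R,
      (g : Matrix (Fin n) (Fin n) R) = 1 + Matrix.vecMulVec u v ∧
      IsElemProd n R (n * (n - 1) * (n + 2)) g := by
  obtain ⟨w, hw⟩ := Ideal.mem_span_range_iff_exists_fun.1 ((Ideal.eq_top_iff_one _).1 hu)
  set f : (Σ _ : Fin n, Fin n) → Fin n → R := fun s =>
    Pi.single s.1 ((v s.1 * w s.2 - v s.2 * w s.1) * u s.2)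
      - Pi.single s.2 ((v s.1 * w s.2 - v s.2 * w s.1) * u s.1) with hf
  have hfu : ∀ s, f s ⬝ᵥ u = 0 := by
    intro s
    simp only [hf, sub_dotProduct, single_dotProduct]
    ring
  have hv : v = ∑ s ∈ Finset.univ.sigma fun i : Fin n => Finset.Ioi i, f s := by
    rw [Finset.sum_sigma]
    exact eq_sum_pairs_of_orthogonal hw hvu
  have key := IsElemProdMatrix.one_add_sum (Finset.univ.sigma fun i : Fin n => Finset.Ioi i)
    (fun s => Matrix.vecMulVec u (f s)) (N := 2 * n + 4)
    (fun s hs => IsElemProdMatrix.one_add_vecMulVec_pair hn u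
      (Finset.mem_Ioi.1 (Finset.mem_sigma.1 hs).2).ne _)
    (fun s _ t _ => by
      rw [Matrix.vecMulVec_mul_vecMulVec, hfu, zero_smul, Matrix.vecMulVec_zero])
  have hcard : (Finset.univ.sigma fun i : Fin n => Finset.Ioi i).card * (2 * n + 4)
      = n * (n - 1) * (n + 2) := by
    rw [← card_sigma_Ioi_mul_two]
    ring
  have hsum : ∑ s ∈ Finset.univ.sigma fun i : Fin n => Finset.Ioi i, Matrix.vecMulVec u (f s)
      = Matrix.vecMulVec u v := by
    ext a b
    conv_rhs => rw [hv]
    simp only [Matrix.sum_apply, Matrix.vecMulVec_apply, Finset.sum_apply, Finset.mul_sum]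
  rw [hcard, hsum] at key
  exact key
end

section
/- Let n ≥ 3, let R be a commutative ring and I an ideal of R. Then the standard commutator formula holds: [SL(n,R), E(n,R,I)] = E(n,R,I) and [E(n,R), C(n,R,I)] = E(n,R,I), where [·,·] denotes the mutual commutator subgroup. -/
open Matrix

/-- The set of elementary transvections of level `I`. -/
def elemSetIdeal (n : ℕ) {R : Type*} [CommRing R] (I : Ideal R) :
    Set (Matrix.SpecialLinearGroup (Fin n) R) :=
  { g | ∃ i j : Fin n, ∃ hij : i ≠ j, ∃ ξ : R, ξ ∈ I ∧ g = elemT i j hij ξ }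

/-- The subgroup `E(n,I)` generated by the elementary transvections of level `I`. -/
def elemSubgroupIdeal (n : ℕ) {R : Type*} [CommRing R] (I : Ideal R) :
    Subgroup (Matrix.SpecialLinearGroup (Fin n) R) :=
  Subgroup.closure (elemSetIdeal n I)

/-- The relative elementary subgroup `E(n,R,I)`: the normal closure of `E(n,I)`
in `E(n,R)`. -/
def relElemSubgroup (n : ℕ) {R : Type*} [CommRing R] (I : Ideal R) :
    Subgroup (Matrix.SpecialLinearGroup (Fin n) R) :=
  Subgroup.closure
    { g | ∃ h ∈ elemSubgroup n R, ∃ x ∈ elemSubgroupIdeal n I, g = h * x * h⁻¹ }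

/-- The principal congruence subgroup `SL(n,R,I)`: the kernel of reduction modulo `I`. -/
def congrSubgroup (n : ℕ) {R : Type*} [CommRing R] (I : Ideal R) :
    Subgroup (Matrix.SpecialLinearGroup (Fin n) R) :=
  (Matrix.SpecialLinearGroup.map (Ideal.Quotient.mk I)).ker

/-- The elementary generator `z_{ij}(ξ,ζ) = t_{ji}(ζ) t_{ij}(ξ) t_{ji}(−ζ)` of the
relative elementary subgroup. -/
def zElem {n : ℕ} {R : Type*} [CommRing R] (i j : Fin n) (hij : i ≠ j) (ξ ζ : R) :
    Matrix.SpecialLinearGroup (Fin n) R :=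
  elemT j i hij.symm ζ * elemT i j hij ξ * elemT j i hij.symm (-ζ)

/-- The set of elementary generators `z_{ij}(ξ,ζ)`, `ξ ∈ I`, `ζ ∈ R`, of `E(n,R,I)`. -/
def zSet (n : ℕ) {R : Type*} [CommRing R] (I : Ideal R) :
    Set (Matrix.SpecialLinearGroup (Fin n) R) :=
  { g | ∃ i j : Fin n, ∃ hij : i ≠ j, ∃ ξ ∈ I, ∃ ζ : R, g = zElem i j hij ξ ζ }

/-- The full congruence subgroup C(n,R,I): preimage of the centre of SL(n,R/I) under
the reduction homomorphism. -/
def fullCongrSubgroup (n : ℕ) {R : Type*} [CommRing R] (I : Ideal R) :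
    Subgroup (Matrix.SpecialLinearGroup (Fin n) R) :=
  (Subgroup.center (Matrix.SpecialLinearGroup (Fin n) (R ⧸ I))).comap
    (Matrix.SpecialLinearGroup.map (Ideal.Quotient.mk I))

open scoped commutatorElement

section Vectors

variable {n : ℕ} {R : Type*} [CommRing R]

/-- The matrix `e + u aᵀ` with `aᵀ u = 0`, as an element of `SL(n,R)`. -/
def vecTransvection (u a : Fin n → R) (h : a ⬝ᵥ u = 0) :
    Matrix.SpecialLinearGroup (Fin n) R :=
  ⟨1 + vecMulVec u a, by
    rw [vecMulVec_eq (ι := Unit), det_one_add_mul_comm]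
    simp [Matrix.mul_apply, dotProduct] at h ⊢
    exact h⟩

theorem coe_vecTransvection (u a : Fin n → R) (h : a ⬝ᵥ u = 0) :
    (vecTransvection u a h : Matrix (Fin n) (Fin n) R) = 1 + vecMulVec u a :=
  rfl

theorem vecTransvection_congr {u u' a a' : Fin n → R} (hu : u = u') (ha : a = a')
    (h : a ⬝ᵥ u = 0) :
    vecTransvection u a h = vecTransvection u' a' (hu ▸ ha ▸ h) := by
  subst hu ha
  rfl

theorem vecTransvection_mul_right (u a b : Fin n → R) (ha : a ⬝ᵥ u = 0) (hb : b ⬝ᵥ u = 0) :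
    vecTransvection u a ha * vecTransvection u b hb =
      vecTransvection u (a + b) (by rw [add_dotProduct, ha, hb, add_zero]) := by
  apply Subtype.ext
  simp only [Matrix.SpecialLinearGroup.coe_mul, coe_vecTransvection, mul_add, add_mul, mul_one, one_mul,
    vecMulVec_mul_vecMulVec, ha, vecMulVec_add, zero_smul, vecMulVec_zero]
  abel

theorem vecTransvection_mul_left (u v a : Fin n → R) (hu : a ⬝ᵥ u = 0) (hv : a ⬝ᵥ v = 0) :
    vecTransvection u a hu * vecTransvection v a hv =
      vecTransvection (u + v) a (by rw [dotProduct_add, hu, hv, add_zero]) := by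
  apply Subtype.ext
  simp only [Matrix.SpecialLinearGroup.coe_mul, coe_vecTransvection, mul_add, add_mul, mul_one, one_mul,
    vecMulVec_mul_vecMulVec, hv, add_vecMulVec, zero_smul, vecMulVec_zero]
  abel

theorem vecTransvection_zero_right (u : Fin n → R) (h : (0 : Fin n → R) ⬝ᵥ u = 0) :
    vecTransvection u 0 h = 1 := by
  apply Subtype.ext
  simp [coe_vecTransvection]

theorem vecTransvection_zero_left (a : Fin n → R) (h : a ⬝ᵥ (0 : Fin n → R) = 0) :
    vecTransvection 0 a h = 1 := by
  apply Subtype.ext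
  simp [coe_vecTransvection]

theorem conj_vecTransvection (g : Matrix.SpecialLinearGroup (Fin n) R) (u a : Fin n → R)
    (h : a ⬝ᵥ u = 0) (h' : (a ᵥ* (g⁻¹).1) ⬝ᵥ (g.1 *ᵥ u) = 0) :
    g * vecTransvection u a h * g⁻¹ = vecTransvection (g.1 *ᵥ u) (a ᵥ* (g⁻¹).1) h' := by
  apply Subtype.ext
  rw [Matrix.SpecialLinearGroup.coe_mul, Matrix.SpecialLinearGroup.coe_mul, coe_vecTransvection,
    coe_vecTransvection, mul_add, add_mul, mul_one, ← Matrix.SpecialLinearGroup.coe_mul, mul_inv_cancel,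
    mul_vecMulVec, vecMulVec_mul, Matrix.SpecialLinearGroup.coe_one]

theorem vecTransvection_single {i j : Fin n} (hij : i ≠ j) (c d : R)
    (h : Pi.single j d ⬝ᵥ Pi.single i c = 0) :
    vecTransvection (Pi.single i c) (Pi.single j d) h = elemT i j hij (c * d) := by
  apply Subtype.ext
  rw [coe_vecTransvection]
  simp only [elemT, transvection]
  congr 1
  ext k l
  simp only [vecMulVec_apply, Matrix.single_apply, Pi.single_apply]
  grind

theorem vecTransvection_sum_right_mem (H : Subgroup (Matrix.SpecialLinearGroup (Fin n) R))
    (u : Fin n → R) {ι : Type*} (s : Finset ι) (f : ι → Fin n → R)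
    (hf : ∀ x ∈ s, ∃ h : f x ⬝ᵥ u = 0, vecTransvection u (f x) h ∈ H) :
    ∃ h : (∑ x ∈ s, f x) ⬝ᵥ u = 0, vecTransvection u (∑ x ∈ s, f x) h ∈ H := by
  refine Finset.sum_induction f (fun a => ∃ h : a ⬝ᵥ u = 0, vecTransvection u a h ∈ H)
    ?_ ?_ hf
  · rintro a b ⟨ha, ha'⟩ ⟨hb, hb'⟩
    refine ⟨by rw [add_dotProduct, ha, hb, add_zero], ?_⟩
    rw [← vecTransvection_mul_right u a b ha hb]
    exact H.mul_mem ha' hb'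
  · refine ⟨zero_dotProduct u, ?_⟩
    rw [vecTransvection_zero_right]
    exact H.one_mem

theorem vecTransvection_sum_left_mem (H : Subgroup (Matrix.SpecialLinearGroup (Fin n) R))
    (a : Fin n → R) {ι : Type*} (s : Finset ι) (f : ι → Fin n → R)
    (hf : ∀ x ∈ s, ∃ h : a ⬝ᵥ f x = 0, vecTransvection (f x) a h ∈ H) :
    ∃ h : a ⬝ᵥ (∑ x ∈ s, f x) = 0, vecTransvection (∑ x ∈ s, f x) a h ∈ H := by
  refine Finset.sum_induction f (fun u => ∃ h : a ⬝ᵥ u = 0, vecTransvection u a h ∈ H)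
    ?_ ?_ hf
  · rintro u v ⟨hu, hu'⟩ ⟨hv, hv'⟩
    refine ⟨by rw [dotProduct_add, hu, hv, add_zero], ?_⟩
    rw [← vecTransvection_mul_left u v a hu hv]
    exact H.mul_mem hu' hv'
  · refine ⟨dotProduct_zero a, ?_⟩
    rw [vecTransvection_zero_left]
    exact H.one_mem

theorem vecTransvection_single_left_mem (I : Ideal R) (m : Fin n) (c : R) (a : Fin n → R)
    (ham : a m = 0) (hI : ∀ k, c * a k ∈ I) (h : a ⬝ᵥ Pi.single m c = 0) :
    vecTransvection (Pi.single m c) a h ∈ elemSubgroupIdeal n I := by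
  obtain ⟨h', hmem⟩ := vecTransvection_sum_right_mem (elemSubgroupIdeal n I) (Pi.single m c)
    Finset.univ (fun k => Pi.single k (a k)) (fun k _ => by
      by_cases hk : m = k
      · subst hk
        rw [ham, Pi.single_zero]
        refine ⟨zero_dotProduct _, ?_⟩
        rw [vecTransvection_zero_right]
        exact Subgroup.one_mem _
      · refine ⟨by simp [hk], ?_⟩
        rw [vecTransvection_single hk]
        exact Subgroup.subset_closure ⟨m, k, hk, _, hI k, rfl⟩)
  rwa [vecTransvection_congr rfl (Finset.univ_sum_single a)] at hmem

theorem vecTransvection_single_right_mem (I : Ideal R) (m : Fin n) (u : Fin n → R)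
    (hum : u m = 0) (hI : ∀ k, u k ∈ I) (h : Pi.single m 1 ⬝ᵥ u = 0) :
    vecTransvection u (Pi.single m 1) h ∈ elemSubgroupIdeal n I := by
  obtain ⟨h', hmem⟩ := vecTransvection_sum_left_mem (elemSubgroupIdeal n I) (Pi.single m 1)
    Finset.univ (fun k => Pi.single k (u k)) (fun k _ => by
      by_cases hk : k = m
      · subst hk
        rw [hum, Pi.single_zero]
        refine ⟨dotProduct_zero _, ?_⟩
        rw [vecTransvection_zero_left]
        exact Subgroup.one_mem _
      · refine ⟨by simp [Ne.symm hk], ?_⟩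
        rw [vecTransvection_single hk, mul_one]
        exact Subgroup.subset_closure ⟨k, m, hk, _, hI k, rfl⟩)
  rwa [vecTransvection_congr (Finset.univ_sum_single u) rfl] at hmem

theorem commutator_vecTransvection (m : Fin n) (u a : Fin n → R)
    (hum : Pi.single m 1 ⬝ᵥ u = 0) (ham : a ⬝ᵥ Pi.single m 1 = 0) (h : a ⬝ᵥ u = 0) :
    ⁅vecTransvection u (Pi.single m 1) hum, vecTransvection (Pi.single m 1) a ham⁆ =
      vecTransvection u a h := by
  rw [commutatorElement_def, mul_inv_eq_iff_eq_mul, mul_inv_eq_iff_eq_mul]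
  apply Subtype.ext
  simp only [Matrix.SpecialLinearGroup.coe_mul, coe_vecTransvection, mul_add, add_mul, mul_one, one_mul,
    vecMulVec_mul_vecMulVec, ham, h, zero_smul, vecMulVec_zero]
  simp only [single_one_dotProduct, Pi.single_eq_same, one_smul]
  simp only [zero_mul, add_zero]
  abel

/-- A decomposition of `e + u aᵀ` with `a m = 0` into factors that are visibly elementary. -/
theorem vecTransvection_eq_commutator_mul (m : Fin n) (u a : Fin n → R) (h : a ⬝ᵥ u = 0)
    (ham : a m = 0) :
    vecTransvection u a h =
      ⁅vecTransvection (u - Pi.single m (u m)) (Pi.single m 1) (by simp),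
        vecTransvection (Pi.single m 1) a (by simp [ham])⁆ *
      vecTransvection (Pi.single m (u m)) a (by simp [ham]) := by
  rw [commutator_vecTransvection _ _ _ _ _ (by simp [h, ham]), vecTransvection_mul_left]
  exact vecTransvection_congr (sub_add_cancel _ _).symm rfl _

end Vectors

section Relative

variable {n : ℕ} {R : Type*} [CommRing R]

theorem elemSubgroupIdeal_le_elemSubgroup (I : Ideal R) :
    elemSubgroupIdeal n I ≤ elemSubgroup n R := by
  refine Subgroup.closure_mono ?_
  rintro g ⟨i, j, hij, ξ, -, rfl⟩
  exact ⟨i, j, hij, ξ, rfl⟩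

theorem elemSubgroupIdeal_le_relElemSubgroup (I : Ideal R) :
    elemSubgroupIdeal n I ≤ relElemSubgroup n I := fun x hx =>
  Subgroup.subset_closure ⟨1, one_mem _, x, hx, by simp⟩

theorem elemT_mem_relElemSubgroup (I : Ideal R) {i j : Fin n} (hij : i ≠ j) {ξ : R}
    (hξ : ξ ∈ I) : elemT i j hij ξ ∈ relElemSubgroup n I :=
  elemSubgroupIdeal_le_relElemSubgroup I (Subgroup.subset_closure ⟨i, j, hij, ξ, hξ, rfl⟩)

theorem conj_mem_relElemSubgroup (I : Ideal R) {h x : Matrix.SpecialLinearGroup (Fin n) R}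
    (hh : h ∈ elemSubgroup n R) (hx : x ∈ relElemSubgroup n I) :
    h * x * h⁻¹ ∈ relElemSubgroup n I := by
  induction hx using Subgroup.closure_induction with
  | mem x hx =>
    obtain ⟨k, hk, y, hy, rfl⟩ := hx
    exact Subgroup.subset_closure ⟨h * k, mul_mem hh hk, y, hy, by group⟩
  | one => simp
  | mul x y _ _ hx hy => simpa [mul_assoc] using mul_mem hx hy
  | inv x _ hx => simpa [mul_assoc] using inv_mem hx

theorem relElemSubgroup_top : relElemSubgroup n (⊤ : Ideal R) = elemSubgroup n R := by
  apply le_antisymm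
  · refine (Subgroup.closure_le _).2 ?_
    rintro g ⟨h, hh, x, hx, rfl⟩
    exact mul_mem (mul_mem hh (elemSubgroupIdeal_le_elemSubgroup _ hx)) (inv_mem hh)
  · refine (Subgroup.closure_le _).2 ?_
    rintro g ⟨i, j, hij, ξ, rfl⟩
    exact elemT_mem_relElemSubgroup _ hij trivial

/-- To lie in a normal subgroup, `E(n,R,I)` only needs its elementary generators to do so. -/
theorem relElemSubgroup_le_of_normal (I : Ideal R)
    (H : Subgroup (Matrix.SpecialLinearGroup (Fin n) R)) [hH : H.Normal]
    (h : ∀ (i j : Fin n) (hij : i ≠ j), ∀ ξ ∈ I, elemT i j hij ξ ∈ H) :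
    relElemSubgroup n I ≤ H := by
  refine (Subgroup.closure_le _).2 ?_
  rintro g ⟨k, -, x, hx, rfl⟩
  refine hH.conj_mem x ?_ k
  refine (Subgroup.closure_le H).2 ?_ hx
  rintro _ ⟨i, j, hij, ξ, hξ, rfl⟩
  exact h i j hij ξ hξ

theorem vecTransvection_mem_relElemSubgroup (I : Ideal R) (m : Fin n) (u a : Fin n → R)
    (h : a ⬝ᵥ u = 0) (ham : a m = 0) (haI : ∀ k, a k ∈ I) :
    vecTransvection u a h ∈ relElemSubgroup n I := by
  rw [vecTransvection_eq_commutator_mul m u a h ham]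
  have hx : vecTransvection (Pi.single m 1) a (by simp [ham]) ∈ relElemSubgroup n I :=
    elemSubgroupIdeal_le_relElemSubgroup I
      (vecTransvection_single_left_mem I m 1 a ham (fun k => by simpa using haI k) _)
  refine mul_mem (mul_mem (conj_mem_relElemSubgroup I ?_ hx) (inv_mem hx)) ?_
  · exact elemSubgroupIdeal_le_elemSubgroup ⊤
      (vecTransvection_single_right_mem ⊤ m _ (by simp) (fun _ => trivial) _)
  · exact elemSubgroupIdeal_le_relElemSubgroup I
      (vecTransvection_single_left_mem I m _ a ham (fun k => I.mul_mem_left _ (haI k)) _)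

/-- The Koszul-type vector `c (u_l e_k - u_k e_l)`, orthogonal to `u`. -/
def koszulVec (u : Fin n → R) (c : R) (k l : Fin n) : Fin n → R :=
  Pi.single k (c * u l) - Pi.single l (c * u k)

theorem koszulVec_dotProduct (u : Fin n → R) (c : R) (k l : Fin n) :
    koszulVec u c k l ⬝ᵥ u = 0 := by
  simp only [koszulVec, sub_dotProduct, single_dotProduct]
  ring

theorem koszulVec_apply_of_ne (u : Fin n → R) (c : R) {k l m : Fin n} (hk : m ≠ k) (hl : m ≠ l) :
    koszulVec u c k l m = 0 := by
  simp [koszulVec, hk, hl]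

theorem sum_koszulVec (u v w : Fin n → R) (hv : v ⬝ᵥ u = 0) (hw : w ⬝ᵥ u = 1) :
    ∑ p : Fin n × Fin n, koszulVec u (v p.1 * w p.2) p.1 p.2 = v := by
  rw [Fintype.sum_prod_type]
  simp only [dotProduct] at hv hw
  ext r
  simp only [koszulVec, Finset.sum_apply, Pi.sub_apply, Finset.sum_sub_distrib, Pi.single_apply,
    Finset.sum_ite_eq, Finset.mem_univ, if_true]
  have h1 : ∑ k, ∑ l, (if r = k then v k * w l * u l else 0) = v r := by
    rw [Finset.sum_comm]
    simp only [Finset.sum_ite_eq, Finset.mem_univ, if_true, mul_assoc, ← Finset.mul_sum, hw,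
      mul_one]
  have h2 : ∑ k, v k * w r * u k = 0 := by
    calc ∑ k, v k * w r * u k = w r * ∑ k, v k * u k := by
          rw [Finset.mul_sum]
          exact Finset.sum_congr rfl fun k _ => by ring
      _ = 0 := by rw [hv, mul_zero]
  rw [h1, h2, sub_zero]

theorem koszulVec_mem_relElemSubgroup (hn : 3 ≤ n) (I : Ideal R) (u : Fin n → R) (c : R)
    (hc : c ∈ I) (k l : Fin n) :
    vecTransvection u (koszulVec u c k l) (koszulVec_dotProduct u c k l) ∈
      relElemSubgroup n I := by
  obtain ⟨m, hk, hl⟩ := Fin.exists_ne_and_ne_of_two_lt k l hn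
  refine vecTransvection_mem_relElemSubgroup I m _ _ _ (koszulVec_apply_of_ne u c hk hl) ?_
  intro r
  simp only [koszulVec, Pi.sub_apply, Pi.single_apply]
  refine I.sub_mem ?_ ?_ <;> split_ifs
  all_goals first | exact I.zero_mem | exact I.mul_mem_right _ hc

theorem elemT_eq_vecTransvection {i j : Fin n} (hij : i ≠ j) (ξ : R) :
    elemT i j hij ξ = vecTransvection (Pi.single i 1) (Pi.single j ξ) (by simp [hij]) := by
  rw [vecTransvection_single hij, one_mul]

theorem elemT_eq_commutator {i j m : Fin n} (hij : i ≠ j) (him : i ≠ m) (hmj : m ≠ j) (ξ : R) :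
    elemT i j hij ξ = ⁅elemT i m him (1 : R), elemT m j hmj ξ⁆ := by
  rw [elemT_eq_vecTransvection hij, elemT_eq_vecTransvection him, elemT_eq_vecTransvection hmj,
    commutator_vecTransvection]

/-- The conjugate `g t_ij(ξ) g⁻¹` is `e + u aᵀ`, with `u` the `i`-th column of `g` and `a` the
`j`-th row of `g⁻¹` scaled by `ξ`. -/
theorem exists_conj_elemT (g : Matrix.SpecialLinearGroup (Fin n) R) {i j : Fin n} (hij : i ≠ j)
    (ξ : R) :
    ∃ h : (ξ • (g⁻¹).1 j) ⬝ᵥ (g.1.col i) = 0,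
      g * elemT i j hij ξ * g⁻¹ = vecTransvection (g.1.col i) (ξ • (g⁻¹).1 j) h := by
  have h1 : g.1 *ᵥ Pi.single i 1 = g.1.col i := by simp
  have h2 : Pi.single j ξ ᵥ* (g⁻¹).1 = ξ • (g⁻¹).1 j := by
    simp [Matrix.row]
  have h : (ξ • (g⁻¹).1 j) ⬝ᵥ (g.1.col i) = 0 := by
    rw [← h1, ← h2, dotProduct_mulVec, vecMul_vecMul, ← Matrix.SpecialLinearGroup.coe_mul,
      inv_mul_cancel]
    simp [hij]
  refine ⟨h, ?_⟩
  rw [elemT_eq_vecTransvection, conj_vecTransvection g _ _ _ (by rw [h1, h2, h])]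
  exact vecTransvection_congr h1 h2 _

theorem inv_row_dotProduct_col (g : Matrix.SpecialLinearGroup (Fin n) R) (k i : Fin n) :
    (g⁻¹).1 k ⬝ᵥ g.1.col i = (1 : Matrix (Fin n) (Fin n) R) k i := by
  have : ((g⁻¹ * g : Matrix.SpecialLinearGroup (Fin n) R) : Matrix (Fin n) (Fin n) R) k i =
      (1 : Matrix (Fin n) (Fin n) R) k i := by
    rw [inv_mul_cancel, Matrix.SpecialLinearGroup.coe_one]
  rw [← this, Matrix.SpecialLinearGroup.coe_mul]
  rfl

/-- Suslin's normality theorem, relative version. -/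
theorem relElemSubgroup_normal (hn : 3 ≤ n) (I : Ideal R) : (relElemSubgroup n I).Normal := by
  have key : ∀ (g : Matrix.SpecialLinearGroup (Fin n) R), ∀ x ∈ elemSubgroupIdeal n I,
      g * x * g⁻¹ ∈ relElemSubgroup n I := by
    intro g x hx
    induction hx using Subgroup.closure_induction with
    | mem x hx =>
      obtain ⟨i, j, hij, ξ, hξ, rfl⟩ := hx
      obtain ⟨h, heq⟩ := exists_conj_elemT g hij ξ
      have hw : (g⁻¹).1 i ⬝ᵥ g.1.col i = 1 := by rw [inv_row_dotProduct_col, one_apply_eq]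
      obtain ⟨h', hmem⟩ := vecTransvection_sum_right_mem (relElemSubgroup n I) (g.1.col i)
        Finset.univ (fun p : Fin n × Fin n =>
          koszulVec (g.1.col i) ((ξ • (g⁻¹).1 j) p.1 * (g⁻¹).1 i p.2) p.1 p.2)
        (fun p _ => ⟨koszulVec_dotProduct _ _ _ _, koszulVec_mem_relElemSubgroup hn I _ _
          (I.mul_mem_right _ (I.mul_mem_right _ hξ)) _ _⟩)
      rwa [heq, ← vecTransvection_congr rfl (sum_koszulVec _ _ _ h hw) h']
    | one => simp
    | mul x y _ _ hx hy => simpa [mul_assoc] using mul_mem hx hy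
    | inv x _ hx => simpa [mul_assoc] using inv_mem hx
  refine ⟨fun x hx g => ?_⟩
  induction hx using Subgroup.closure_induction with
  | mem x hx =>
    obtain ⟨k, hk, y, hy, rfl⟩ := hx
    simpa [mul_assoc] using key (g * k) y hy
  | one => simp
  | mul x y _ _ hx hy => simpa [mul_assoc] using mul_mem hx hy
  | inv x _ hx => simpa [mul_assoc] using inv_mem hx

theorem elemSubgroup_normal (hn : 3 ≤ n) : (elemSubgroup n R).Normal :=
  relElemSubgroup_top (n := n) (R := R) ▸ relElemSubgroup_normal hn ⊤

theorem relElemSubgroup_le_commutator (hn : 3 ≤ n) (I : Ideal R) :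
    relElemSubgroup n I ≤ ⁅elemSubgroup n R, relElemSubgroup n I⁆ := by
  have := elemSubgroup_normal (R := R) hn
  have := relElemSubgroup_normal hn I
  refine relElemSubgroup_le_of_normal I _ fun i j hij ξ hξ => ?_
  obtain ⟨m, hi, hj⟩ := Fin.exists_ne_and_ne_of_two_lt i j hn
  rw [elemT_eq_commutator hij hi.symm hj]
  exact Subgroup.commutator_mem_commutator (Subgroup.subset_closure ⟨i, m, hi.symm, 1, rfl⟩)
    (elemT_mem_relElemSubgroup I hj hξ)

/-- A transvection congruent to `t_ij(ξ)` modulo `I`, whose covector vanishes at some index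
different from `i` and `j`, is congruent to it modulo `E(n,R,I)`. -/
theorem vecTransvection_mk_eq (I : Ideal R) [(relElemSubgroup n I).Normal] {i j m : Fin n}
    (hij : i ≠ j) (him : i ≠ m) (hmj : m ≠ j) (ξ : R) (u a : Fin n → R) (h : a ⬝ᵥ u = 0)
    (ham : a m = 0) (hu : ∀ k, (u - Pi.single i 1 : Fin n → R) k ∈ I) (ha : ∀ k, (a - Pi.single j ξ : Fin n → R) k ∈ I) :
    (QuotientGroup.mk (vecTransvection u a h) :
        Matrix.SpecialLinearGroup (Fin n) R ⧸ relElemSubgroup n I) =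
      QuotientGroup.mk (elemT i j hij ξ) := by
  have hum : u m ∈ I := by simpa [him.symm] using hu m
  set u' := u - Pi.single m (u m) with hu'
  have hum' : u' m = 0 := by simp [hu']
  have e1 : vecTransvection u' (Pi.single m 1) (by simp [hum']) =
      elemT i m him 1 * vecTransvection (u' - Pi.single i 1) (Pi.single m 1)
        (by simp [hum', him.symm]) := by
    rw [elemT_eq_vecTransvection, vecTransvection_mul_left]
    exact vecTransvection_congr (add_sub_cancel _ _).symm rfl _
  have e2 : vecTransvection (Pi.single m 1) a (by simp [ham]) =
      elemT m j hmj ξ * vecTransvection (Pi.single m 1) (a - Pi.single j ξ)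
        (by simp [ham, hmj]) := by
    rw [elemT_eq_vecTransvection, vecTransvection_mul_right]
    exact vecTransvection_congr rfl (add_sub_cancel _ _).symm _
  have m1 : vecTransvection (u' - Pi.single i 1) (Pi.single m 1) (by simp [hum', him.symm]) ∈
      relElemSubgroup n I := by
    refine elemSubgroupIdeal_le_relElemSubgroup I
      (vecTransvection_single_right_mem I m _ (by simp [hum', him.symm]) (fun k => ?_) _)
    have : (u' - Pi.single i 1 : Fin n → R) k = (u - Pi.single i 1 : Fin n → R) k - (Pi.single m (u m) : Fin n → R) k := by
      simp only [hu', Pi.sub_apply]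
      ring
    rw [this]
    refine I.sub_mem (hu k) ?_
    rw [Pi.single_apply]
    split_ifs
    exacts [hum, I.zero_mem]
  have m2 : vecTransvection (Pi.single m 1) (a - Pi.single j ξ) (by simp [ham, hmj]) ∈
      relElemSubgroup n I :=
    elemSubgroupIdeal_le_relElemSubgroup I
      (vecTransvection_single_left_mem I m 1 _ (by simp [ham, hmj])
        (fun k => by simpa using ha k) _)
  have m3 : vecTransvection (Pi.single m (u m)) a (by simp [ham]) ∈ relElemSubgroup n I :=
    elemSubgroupIdeal_le_relElemSubgroup I
      (vecTransvection_single_left_mem I m _ a ham (fun k => I.mul_mem_right _ hum) _)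
  rw [vecTransvection_eq_commutator_mul m u a h ham, elemT_eq_commutator hij him hmj]
  rw [QuotientGroup.mk_mul_of_mem _ m3, ← QuotientGroup.mk'_apply, ← QuotientGroup.mk'_apply,
    map_commutatorElement, map_commutatorElement, e1, e2]
  simp only [QuotientGroup.mk'_apply]
  rw [QuotientGroup.mk_mul_of_mem _ m1, QuotientGroup.mk_mul_of_mem _ m2]

theorem conj_elemT_mk_eq (hn : 3 ≤ n) (I : Ideal R) [(relElemSubgroup n I).Normal]
    (g : Matrix.SpecialLinearGroup (Fin n) R) (hg : g ∈ congrSubgroup n I)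
    {i j : Fin n} (hij : i ≠ j) (ξ : R) :
    (QuotientGroup.mk (g * elemT i j hij ξ * g⁻¹) :
        Matrix.SpecialLinearGroup (Fin n) R ⧸ relElemSubgroup n I) =
      QuotientGroup.mk (elemT i j hij ξ) := by
  have hcong : ∀ x ∈ congrSubgroup n I, ∀ k l,
      Ideal.Quotient.mk I (x.1 k l) = (1 : Matrix (Fin n) (Fin n) (R ⧸ I)) k l := by
    intro x hx k l
    have := congrArg (fun y : Matrix.SpecialLinearGroup (Fin n) (R ⧸ I) => y.1 k l)
      (MonoidHom.mem_ker.1 hx)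
    simpa using this
  have hg1 := hcong g hg
  have hg2 := hcong g⁻¹ (inv_mem hg)
  obtain ⟨h, heq⟩ := exists_conj_elemT g hij ξ
  have hw : (g⁻¹).1 i ⬝ᵥ g.1.col i = 1 := by rw [inv_row_dotProduct_col, one_apply_eq]
  set u := g.1.col i with hu
  set w := (g⁻¹).1 i with hw'
  set v := (g⁻¹).1 j with hv'
  have hu_mk : ∀ k, Ideal.Quotient.mk I (u k) = if k = i then 1 else 0 := fun k => by
    rw [← one_apply, ← hg1 k i]
    rfl
  have hw_mk : ∀ k, Ideal.Quotient.mk I (w k) = if i = k then 1 else 0 := fun k => by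
    rw [← one_apply, ← hg2 i k]
  have hv_mk : ∀ k, Ideal.Quotient.mk I (v k) = if j = k then 1 else 0 := fun k => by
    rw [← one_apply, ← hg2 j k]
  obtain ⟨h', hmem⟩ := vecTransvection_sum_right_mem (relElemSubgroup n I) u
    (Finset.univ.erase (j, i)) (fun p : Fin n × Fin n =>
      koszulVec u ((ξ • v) p.1 * w p.2) p.1 p.2)
    (fun p hp => ⟨koszulVec_dotProduct _ _ _ _, koszulVec_mem_relElemSubgroup hn I _ _ (by
      obtain ⟨k, l⟩ := p
      have hne : ¬ (j = k ∧ i = l) := fun hkl =>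
        (Finset.mem_erase.1 hp).1 (by rw [hkl.1, hkl.2])
      rw [← Ideal.Quotient.eq_zero_iff_mem]
      simp only [Pi.smul_apply, smul_eq_mul, map_mul, hv_mk, hw_mk]
      split_ifs <;> simp_all) _ _⟩)
  have hsum : koszulVec u ((ξ • v) j * w i) j i + ∑ p ∈ Finset.univ.erase (j, i),
      koszulVec u ((ξ • v) p.1 * w p.2) p.1 p.2 = ξ • v := by
    rw [Finset.add_sum_erase Finset.univ (fun p : Fin n × Fin n =>
      koszulVec u ((ξ • v) p.1 * w p.2) p.1 p.2) (Finset.mem_univ (j, i)),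
      sum_koszulVec u (ξ • v) w h hw]
  obtain ⟨m, hi, hj⟩ := Fin.exists_ne_and_ne_of_two_lt i j hn
  rw [heq, vecTransvection_congr rfl hsum.symm, ← vecTransvection_mul_right u _ _
    (koszulVec_dotProduct _ _ _ _) h', QuotientGroup.mk_mul_of_mem _ hmem]
  refine vecTransvection_mk_eq I hij hi.symm hj ξ u _ _ (koszulVec_apply_of_ne _ _ hj hi) ?_ ?_
  · intro k
    rw [← Ideal.Quotient.eq_zero_iff_mem, Pi.sub_apply, map_sub, hu_mk, Pi.single_apply]
    split_ifs <;> simp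
  · intro k
    rw [← Ideal.Quotient.eq_zero_iff_mem]
    simp only [koszulVec, Pi.sub_apply, map_sub, Pi.single_apply, Pi.smul_apply, smul_eq_mul]
    split_ifs <;> simp_all [hij.symm]

theorem commutator_elemSubgroup_congrSubgroup_le (hn : 3 ≤ n) (I : Ideal R) :
    ⁅elemSubgroup n R, congrSubgroup n I⁆ ≤ relElemSubgroup n I := by
  have := relElemSubgroup_normal hn I
  rw [Subgroup.commutator_comm, ← QuotientGroup.ker_mk' (relElemSubgroup n I),
    ← (Subgroup.map_eq_bot_iff _), Subgroup.map_commutator, Subgroup.commutator_comm,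
    Subgroup.commutator_eq_bot_iff_le_centralizer, Subgroup.map_le_iff_le_comap]
  refine (Subgroup.closure_le _).2 ?_
  rintro _ ⟨i, j, hij, ξ, rfl⟩
  refine Subgroup.mem_centralizer_iff.2 ?_
  rintro _ ⟨g, hg, rfl⟩
  have := conj_elemT_mk_eq hn I g hg hij ξ
  rw [QuotientGroup.mk_mul, QuotientGroup.mk_inv, mul_inv_eq_iff_eq_mul,
    QuotientGroup.mk_mul] at this
  exact this

theorem commutator_fullCongrSubgroup_le_congrSubgroup (I : Ideal R)
    (H : Subgroup (Matrix.SpecialLinearGroup (Fin n) R)) :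
    ⁅fullCongrSubgroup n I, H⁆ ≤ congrSubgroup n I := by
  refine Subgroup.commutator_le.2 fun c hc g _ => ?_
  rw [congrSubgroup, MonoidHom.mem_ker, map_commutatorElement,
    commutatorElement_eq_one_iff_mul_comm]
  exact (Subgroup.mem_center_iff.1 (Subgroup.mem_comap.1 hc) _).symm

theorem relElemSubgroup_le_fullCongrSubgroup (I : Ideal R) :
    relElemSubgroup n I ≤ fullCongrSubgroup n I := by
  have : (fullCongrSubgroup n I).Normal := Subgroup.Normal.comap inferInstance _
  refine relElemSubgroup_le_of_normal I _ fun i j hij ξ hξ => ?_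
  have : Matrix.SpecialLinearGroup.map (Ideal.Quotient.mk I) (elemT i j hij ξ) = 1 := by
    apply Subtype.ext
    change (Ideal.Quotient.mk I).mapMatrix (1 + Matrix.single i j ξ) = 1
    rw [map_add, map_one, RingHom.mapMatrix_apply]
    simp [Ideal.Quotient.eq_zero_iff_mem.2 hξ]
  rw [fullCongrSubgroup, Subgroup.mem_comap, this]
  exact one_mem _

theorem commutator_elemSubgroup_fullCongrSubgroup_le (hn : 3 ≤ n) (I : Ideal R) :
    ⁅elemSubgroup n R, fullCongrSubgroup n I⁆ ≤ relElemSubgroup n I := by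
  have hN := relElemSubgroup_normal hn I
  have hperf : elemSubgroup n R ≤ ⁅elemSubgroup n R, elemSubgroup n R⁆ := by
    simpa only [relElemSubgroup_top] using relElemSubgroup_le_commutator hn (⊤ : Ideal R)
  set π := QuotientGroup.mk' (relElemSubgroup n I)
  have hbot : ∀ H : Subgroup (Matrix.SpecialLinearGroup (Fin n) R),
      H.map π = ⊥ ↔ H ≤ relElemSubgroup n I := fun H => by
    rw [Subgroup.map_eq_bot_iff, QuotientGroup.ker_mk']
  have hECE : ⁅⁅fullCongrSubgroup n I, elemSubgroup n R⁆, elemSubgroup n R⁆ ≤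
      relElemSubgroup n I := by
    refine le_trans ?_ (commutator_elemSubgroup_congrSubgroup_le hn I)
    rw [Subgroup.commutator_comm (elemSubgroup n R)]
    exact Subgroup.commutator_mono (commutator_fullCongrSubgroup_le_congrSubgroup I _) le_rfl
  have h1 := (hbot _).2 hECE
  rw [Subgroup.map_commutator, Subgroup.map_commutator] at h1
  have h2 := h1
  rw [Subgroup.commutator_comm ((fullCongrSubgroup n I).map π)] at h2
  have h3 := Subgroup.commutator_commutator_eq_bot_of_rotate h2 h1
  rw [← Subgroup.map_commutator, ← Subgroup.map_commutator, hbot] at h3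
  exact (Subgroup.commutator_mono hperf le_rfl).trans h3

end Relative

/-- The standard commutator formula: for n ≥ 3,
[SL(n,R), E(n,R,I)] = [E(n,R), C(n,R,I)] = E(n,R,I). -/
theorem standard_commutator_formula (n : ℕ) (hn : 3 ≤ n)
    (R : Type*) [CommRing R] (I : Ideal R) :
    ⁅(⊤ : Subgroup (Matrix.SpecialLinearGroup (Fin n) R)), relElemSubgroup n I⁆ =
        relElemSubgroup n I ∧
      ⁅elemSubgroup n R, fullCongrSubgroup n I⁆ = relElemSubgroup n I := by
  have := relElemSubgroup_normal hn I
  have hle := relElemSubgroup_le_commutator hn I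
  exact ⟨le_antisymm (Subgroup.commutator_le_right _ _)
      (hle.trans (Subgroup.commutator_mono le_top le_rfl)),
    le_antisymm (commutator_elemSubgroup_fullCongrSubgroup_le hn I)
      (hle.trans (Subgroup.commutator_mono le_rfl (relElemSubgroup_le_fullCongrSubgroup I)))⟩
end
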